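/- arXiv:1704.06969 — 12 statements merged into one kernel-verified Lean document; each statement's English description precedes it below -/
import Mathlib

section
/- Let P ⊆ ℝ², let A ⊆ P, and let M be a finite set of points of A such that no point of M is seen from any point of P \ A and no point of P sees two distinct points of M. Suppose there is a point p ∈ A and a nonempty set W ⊆ A such that (1) no point of W is seen from any point of P \ A, (2) p is the unique point of P that sees every point of W, and (3) no point of P sees both a point of M and a point of W. Then every finite guard set G of P satisfies |G ∩ A| ≥ |M| + 1, and if moreover |G ∩ A| = |M| + 1 then p ∈ G. -/
/-- A point `g` of `P` sees a point `q` if the closed segment from `g` to `q`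
is contained in `P`. -/
def Sees (P : Set (ℝ × ℝ)) (g q : ℝ × ℝ) : Prop := segment ℝ g q ⊆ P

theorem stationary_guard
    (P A M : Set (ℝ × ℝ)) (hMfin : M.Finite) (hAP : A ⊆ P) (hMA : M ⊆ A)
    (hMnotSeen : ∀ m ∈ M, ∀ g ∈ P \ A, ¬ Sees P g m)
    (hMsep : ∀ g ∈ P, ∀ m₁ ∈ M, ∀ m₂ ∈ M, Sees P g m₁ → Sees P g m₂ → m₁ = m₂)
    (p : ℝ × ℝ) (hp : p ∈ A)
    (W : Set (ℝ × ℝ)) (hWA : W ⊆ A) (hWne : W.Nonempty)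
    (hW1 : ∀ w ∈ W, ∀ g ∈ P \ A, ¬ Sees P g w)
    (hW2 : ∀ g ∈ P, ((∀ w ∈ W, Sees P g w) ↔ g = p))
    (hW3 : ∀ g ∈ P, ¬ ((∃ m ∈ M, Sees P g m) ∧ (∃ w ∈ W, Sees P g w)))
    (G : Set (ℝ × ℝ)) (hGfin : G.Finite) (hGP : G ⊆ P)
    (hGuard : ∀ q ∈ P, ∃ g ∈ G, Sees P g q) :
    M.ncard + 1 ≤ (G ∩ A).ncard ∧ ((G ∩ A).ncard = M.ncard + 1 → p ∈ G) := by
  have key : ∀ q ∈ A, (∀ g ∈ P \ A, ¬ Sees P g q) → ∃ g ∈ G ∩ A, Sees P g q := by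
    intro q hq hn
    obtain ⟨g, hg, hs⟩ := hGuard q (hAP hq)
    refine ⟨g, ⟨hg, ?_⟩, hs⟩
    by_contra hgA
    exact hn g ⟨hGP hg, hgA⟩ hs
  have keyM : ∀ m : ℝ × ℝ, ∃ g, m ∈ M → g ∈ G ∩ A ∧ Sees P g m := by
    intro m
    by_cases hm : m ∈ M
    · obtain ⟨g, hg, hs⟩ := key m (hMA hm) (hMnotSeen m hm)
      exact ⟨g, fun _ => ⟨hg, hs⟩⟩
    · exact ⟨p, fun h => absurd h hm⟩
  choose f hf using keyM
  have hinj : Set.InjOn f M := by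
    intro a ha b hb hab
    refine hMsep (f a) (hGP (hf a ha).1.1) a ha b hb (hf a ha).2 ?_
    rw [hab]
    exact (hf b hb).2
  have hcard : (f '' M).ncard = M.ncard := Set.ncard_image_of_injOn hinj
  have hnot : ∀ g w, w ∈ W → Sees P g w → g ∉ f '' M := by
    rintro g w hw hs ⟨m, hm, rfl⟩
    exact hW3 (f m) (hGP (hf m hm).1.1) ⟨⟨m, hm, (hf m hm).2⟩, ⟨w, hw, hs⟩⟩
  obtain ⟨w0, hw0⟩ := hWne
  obtain ⟨g0, hg0, hs0⟩ := key w0 (hWA hw0) (hW1 w0 hw0)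
  have hfin : (G ∩ A).Finite := hGfin.subset Set.inter_subset_left
  have hsub : insert g0 (f '' M) ⊆ G ∩ A := by
    rintro x (rfl | ⟨m, hm, rfl⟩)
    · exact hg0
    · exact (hf m hm).1
  have hc : (insert g0 (f '' M)).ncard = M.ncard + 1 := by
    rw [Set.ncard_insert_of_notMem (hnot g0 w0 hw0 hs0) (hMfin.image f), hcard]
  refine ⟨hc ▸ Set.ncard_le_ncard hsub hfin, fun heq => ?_⟩
  have hE : insert g0 (f '' M) = G ∩ A :=
    Set.eq_of_subset_of_ncard_le hsub (by rw [heq, hc]) hfin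
  have hall : ∀ w ∈ W, Sees P g0 w := by
    intro w hw
    obtain ⟨g, hg, hs⟩ := key w (hWA hw) (hW1 w hw)
    rw [← hE] at hg
    rcases hg with rfl | hg
    · exact hs
    · exact absurd hg (hnot g w hw hs)
  have := (hW2 g0 (hGP hg0.1)).1 hall
  exact this ▸ hg0.1
end

section
/- Let P ⊆ ℝ², let A ⊆ P, and let M be a finite set of points of A such that no point of M is seen from any point of P \ A and no point of P sees two distinct points of M. Suppose there is a closed line segment s contained in A and four points t₀, t₁, u₀, u₁ ∈ A such that (1) none of t₀, t₁, u₀, u₁ is seen from any point of P \ A, (2) a point q ∈ P sees all four points t₀, t₁, u₀, u₁ if and only if q lies on s, and (3) no point of P sees both a point of M and one of the points t₀, t₁, u₀, u₁. Then every finite guard set G of P satisfies |G ∩ A| ≥ |M| + 1, and if moreover |G ∩ A| = |M| + 1 then G contains a point lying on s. -/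
theorem guard_segment
    (P A M : Set (ℝ × ℝ)) (hMfin : M.Finite) (hAP : A ⊆ P) (hMA : M ⊆ A)
    (hMnotSeen : ∀ m ∈ M, ∀ g ∈ P \ A, ¬ Sees P g m)
    (hMsep : ∀ g ∈ P, ∀ m₁ ∈ M, ∀ m₂ ∈ M, Sees P g m₁ → Sees P g m₂ → m₁ = m₂)
    (s₀ s₁ : ℝ × ℝ) (hsA : segment ℝ s₀ s₁ ⊆ A)
    (t₀ t₁ u₀ u₁ : ℝ × ℝ) (htuA : t₀ ∈ A ∧ t₁ ∈ A ∧ u₀ ∈ A ∧ u₁ ∈ A)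
    (h1 : ∀ v ∈ ({t₀, t₁, u₀, u₁} : Set (ℝ × ℝ)), ∀ g ∈ P \ A, ¬ Sees P g v)
    (h2 : ∀ q ∈ P, ((Sees P q t₀ ∧ Sees P q t₁ ∧ Sees P q u₀ ∧ Sees P q u₁) ↔
      q ∈ segment ℝ s₀ s₁))
    (h3 : ∀ g ∈ P, ¬ ((∃ m ∈ M, Sees P g m) ∧
      (∃ v ∈ ({t₀, t₁, u₀, u₁} : Set (ℝ × ℝ)), Sees P g v)))
    (G : Set (ℝ × ℝ)) (hGfin : G.Finite) (hGP : G ⊆ P)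
    (hGuard : ∀ q ∈ P, ∃ g ∈ G, Sees P g q) :
    M.ncard + 1 ≤ (G ∩ A).ncard ∧
      ((G ∩ A).ncard = M.ncard + 1 → ∃ g ∈ G, g ∈ segment ℝ s₀ s₁) := by
  have seen : ∀ v ∈ A, (∀ g ∈ P \ A, ¬ Sees P g v) → ∃ g ∈ G ∩ A, Sees P g v := by
    intro v hv hn
    obtain ⟨g, hg, hs⟩ := hGuard v (hAP hv)
    refine ⟨g, ⟨hg, ?_⟩, hs⟩
    by_contra hgA
    exact hn g ⟨hGP hg, hgA⟩ hs
  have hM : ∀ m : ℝ × ℝ, ∃ g, m ∈ M → g ∈ G ∩ A ∧ Sees P g m := by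
    intro m
    by_cases hm : m ∈ M
    · obtain ⟨g, hg, hs⟩ := seen m (hMA hm) (hMnotSeen m hm)
      exact ⟨g, fun _ => ⟨hg, hs⟩⟩
    · exact ⟨m, fun h => absurd h hm⟩
  choose f hf using hM
  have hinj : Set.InjOn f M := by
    intro a ha b hb hab
    refine hMsep (f a) (hGP (hf a ha).1.1) a ha b hb (hf a ha).2 ?_
    rw [hab]
    exact (hf b hb).2
  have hcard : (f '' M).ncard = M.ncard := Set.ncard_image_of_injOn hinj
  have hsub : f '' M ⊆ G ∩ A := by
    rintro _ ⟨m, hm, rfl⟩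
    exact (hf m hm).1
  have hfin : (G ∩ A).Finite := hGfin.subset Set.inter_subset_left
  have hdiff : ((G ∩ A) \ f '' M).ncard + M.ncard = (G ∩ A).ncard := by
    rw [← hcard]
    exact Set.ncard_sdiff_add_ncard_of_subset hsub hfin
  have hv : ∀ v ∈ ({t₀, t₁, u₀, u₁} : Set (ℝ × ℝ)), v ∈ A →
      ∃ g ∈ (G ∩ A) \ f '' M, Sees P g v := by
    intro v hv hvA
    obtain ⟨g, hg, hs⟩ := seen v hvA (h1 v hv)
    refine ⟨g, ⟨hg, ?_⟩, hs⟩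
    rintro ⟨m, hm, rfl⟩
    exact h3 _ (hGP hg.1) ⟨⟨m, hm, (hf m hm).2⟩, v, hv, hs⟩
  obtain ⟨ht₀, ht₁, hu₀, hu₁⟩ := htuA
  obtain ⟨a, ha, hsa⟩ := hv t₀ (by simp) ht₀
  obtain ⟨b, hb, hsb⟩ := hv t₁ (by simp) ht₁
  obtain ⟨c, hc, hsc⟩ := hv u₀ (by simp) hu₀
  obtain ⟨d, hd, hsd⟩ := hv u₁ (by simp) hu₁
  have hfin' : ((G ∩ A) \ f '' M).Finite := hfin.subset Set.diff_subset
  have hpos : 0 < ((G ∩ A) \ f '' M).ncard := (Set.ncard_pos hfin').2 ⟨a, ha⟩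
  refine ⟨by omega, fun heq => ?_⟩
  have hle : ((G ∩ A) \ f '' M).ncard ≤ 1 := by omega
  have huniq := (Set.ncard_le_one hfin').1 hle
  obtain rfl := huniq a ha b hb
  obtain rfl := huniq a ha c hc
  obtain rfl := huniq a ha d hd
  exact ⟨a, ha.1.1, (h2 a (hGP ha.1.1)).1 ⟨hsa, hsb, hsc, hsd⟩⟩
end

section
/- Let a₀, b₀, a₁, b₁, c₀, c₁, f₀, f₁, e, q₀, q₁ be points of ℝ² and λ, μ be reals. Assume: a₀ ≠ b₀ and a₀, b₀ have the same y-coordinate y₀; a₁ ≠ b₁ and a₁, b₁ have the same y-coordinate y₁; c₀ and c₁ have the same y-coordinate y_c, where y_c ≠ y₀ and y_c ≠ y₁; f₁ is collinear with a₀ and c₀, and f₁ is collinear with a₁ and c₁; f₀ is collinear with b₀ and c₀, and f₀ is collinear with b₁ and c₁; e is collinear with f₀ and f₁; the y-coordinates of f₀ and f₁ are distinct, and each of them differs both from y_c and from the y-coordinate of e; the y-coordinate of e differs from y_c; q₀ = a₀ + λ·(b₀ − a₀) and q₀ is collinear with c₀ and e; q₁ = a₁ + μ·(b₁ − a₁)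 and q₁ is collinear with c₁ and e. Then λ = μ. (In the terminology of the paper: for a copy-nook or copy-umbra with shadow corners c₀, c₁ at equal heights, the two preimages of a point e of the critical segment f₀f₁ under the projections from the two horizontal guard segments a₀b₀ and a₁b₁ represent the same value.) -/
theorem collinear_det {p q r : ℝ × ℝ} (h : Collinear ℝ ({p, q, r} : Set (ℝ × ℝ))) :
    (q.1 - p.1) * (r.2 - p.2) = (r.1 - p.1) * (q.2 - p.2) := by
  rw [collinear_iff_of_mem (p₀ := p) (by simp)] at h
  obtain ⟨v, hv⟩ := h
  obtain ⟨s, hs⟩ := hv q (by simp)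
  obtain ⟨t, ht⟩ := hv r (by simp)
  subst hs ht
  simp only [vadd_eq_add, Prod.fst_add, Prod.snd_add, Prod.smul_fst, Prod.smul_snd, smul_eq_mul]
  ring

theorem ratio_aux (a b c f₀ f₁ e q : ℝ × ℝ) (lam : ℝ)
    (hab : a ≠ b) (hy : a.2 = b.2) (hc : c.2 ≠ a.2)
    (h1 : Collinear ℝ ({f₁, a, c} : Set (ℝ × ℝ)))
    (h0 : Collinear ℝ ({f₀, b, c} : Set (ℝ × ℝ)))
    (he : Collinear ℝ ({e, f₀, f₁} : Set (ℝ × ℝ)))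
    (hq : q = a + lam • (b - a))
    (hqc : Collinear ℝ ({c, e, q} : Set (ℝ × ℝ))) :
    lam * ((e.2 - c.2) * (f₁.2 - f₀.2)) = (f₀.2 - c.2) * (f₁.2 - e.2) := by
  have d : b.1 - a.1 ≠ 0 := fun h => hab (Prod.ext (by linarith) hy)
  have k1 := collinear_det h1
  have k0 := collinear_det h0
  have ke := collinear_det he
  have kq := collinear_det hqc
  subst hq
  simp only [Prod.fst_add, Prod.snd_add, Prod.smul_fst, Prod.smul_snd, smul_eq_mul,
    Prod.fst_sub, Prod.snd_sub] at kq
  obtain ⟨ax, ay⟩ := a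
  obtain ⟨bx, b2⟩ := b
  simp only at *
  subst hy
  have m1 : (f₁.1 - c.1) * (ay - c.2) = (ax - c.1) * (f₁.2 - c.2) := by linarith
  have m0 : (f₀.1 - c.1) * (ay - c.2) = (bx - c.1) * (f₀.2 - c.2) := by linarith
  have mq : (e.1 - c.1) * (ay - c.2) = (ax - c.1 + lam * (bx - ax)) * (e.2 - c.2) := by linarith
  have me : (e.1 - f₀.1) * (f₁.2 - f₀.2) = (f₁.1 - f₀.1) * (e.2 - f₀.2) := by linarith
  apply mul_left_cancel₀ d
  linear_combination (ay - c.2) * me - (f₁.2 - f₀.2) * mq + (f₁.2 - f₀.2) * m0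
    + (e.2 - f₀.2) * m1 - (e.2 - f₀.2) * m0

/-- Lemma `copy-proof`: for a copy-nook or copy-umbra with shadow corners `c₀, c₁`
at equal heights, the two preimages of a point `e` of the critical segment `f₀f₁`
under the projections from the two horizontal guard segments `a₀b₀` and `a₁b₁`
represent the same value. -/
theorem copy_proof
    (a₀ b₀ a₁ b₁ c₀ c₁ f₀ f₁ e q₀ q₁ : ℝ × ℝ) (lam mu : ℝ)
    (hab₀ : a₀ ≠ b₀) (hy₀ : a₀.2 = b₀.2)
    (hab₁ : a₁ ≠ b₁) (hy₁ : a₁.2 = b₁.2)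
    (hyc : c₀.2 = c₁.2) (hc₀y₀ : c₀.2 ≠ a₀.2) (hc₀y₁ : c₀.2 ≠ a₁.2)
    (hf₁a₀ : Collinear ℝ ({f₁, a₀, c₀} : Set (ℝ × ℝ)))
    (hf₁a₁ : Collinear ℝ ({f₁, a₁, c₁} : Set (ℝ × ℝ)))
    (hf₀b₀ : Collinear ℝ ({f₀, b₀, c₀} : Set (ℝ × ℝ)))
    (hf₀b₁ : Collinear ℝ ({f₀, b₁, c₁} : Set (ℝ × ℝ)))
    (he : Collinear ℝ ({e, f₀, f₁} : Set (ℝ × ℝ)))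
    (hf₀f₁ : f₀.2 ≠ f₁.2)
    (hf₀c : f₀.2 ≠ c₀.2) (hf₁c : f₁.2 ≠ c₀.2)
    (hf₀e : f₀.2 ≠ e.2) (hf₁e : f₁.2 ≠ e.2)
    (hec : e.2 ≠ c₀.2)
    (hq₀ : q₀ = a₀ + lam • (b₀ - a₀))
    (hq₀c : Collinear ℝ ({c₀, e, q₀} : Set (ℝ × ℝ)))
    (hq₁ : q₁ = a₁ + mu • (b₁ - a₁))
    (hq₁c : Collinear ℝ ({c₁, e, q₁} : Set (ℝ × ℝ))) :
    lam = mu := by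
  have r0 := ratio_aux a₀ b₀ c₀ f₀ f₁ e q₀ lam hab₀ hy₀ hc₀y₀ hf₁a₀ hf₀b₀ he hq₀ hq₀c
  have r1 := ratio_aux a₁ b₁ c₁ f₀ f₁ e q₁ mu hab₁ hy₁ (hyc ▸ hc₀y₁) hf₁a₁ hf₀b₁ he hq₁ hq₁c
  rw [← hyc] at r1
  exact mul_right_cancel₀ (mul_ne_zero (sub_ne_zero.2 hec) (sub_ne_zero.2 hf₀f₁.symm))
    (r0.trans r1.symm)
end

section
/- Let v, h, w be real numbers with v > 0, h > 0 and w > v + 3/2, and let x, y ∈ [1/2, 2]. Put g₁ := (w − 2 + x, 0), g₂ := (−w − 1/2 + y, 0), e₁ := (v, h), e₂ := (−v, h), e₃ := (0, h). Suppose γ ∈ ℝ² is collinear with g₁ and e₁ and also collinear with g₂ and e₂, and suppose χ ∈ ℝ² has y-coordinate −h and is collinear with γ and e₃. Then the x-coordinate of χ equals x + y − 5/2. (This is the coordinate computation underlying the ≥-addition gadget: the guard (−5/2 + z, −h) lies at or to the left of χ if and only if x + y ≥ z.) -/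
/-- Collinear triples in the plane have vanishing cross product. -/
lemma cross_eq_of_collinear {P Q R : ℝ × ℝ}
    (H : Collinear ℝ ({P, Q, R} : Set (ℝ × ℝ))) :
    (Q.1 - P.1) * (R.2 - P.2) = (R.1 - P.1) * (Q.2 - P.2) := by
  rw [collinear_iff_of_mem (p₀ := P) (by simp)] at H
  obtain ⟨d, H⟩ := H
  obtain ⟨a, ha⟩ := H Q (by simp)
  obtain ⟨b, hb⟩ := H R (by simp)
  rw [ha, hb]
  simp
  ring

/-- Coordinate computation underlying the `≥`-addition gadget. -/
theorem geq_addition_gadget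
    (v h w x y : ℝ) (hv : 0 < v) (hh : 0 < h) (hw : v + 3/2 < w)
    (hx : x ∈ Set.Icc (1/2 : ℝ) 2) (hy : y ∈ Set.Icc (1/2 : ℝ) 2)
    (γ χ : ℝ × ℝ)
    (hγ₁ : Collinear ℝ ({γ, (w - 2 + x, 0), (v, h)} : Set (ℝ × ℝ)))
    (hγ₂ : Collinear ℝ ({γ, (-w - 1/2 + y, 0), (-v, h)} : Set (ℝ × ℝ)))
    (hχy : χ.2 = -h)
    (hχ : Collinear ℝ ({γ, (0, h), χ} : Set (ℝ × ℝ))) :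
    χ.1 = x + y - 5/2 := by
  have h1 := cross_eq_of_collinear hγ₁
  have h2 := cross_eq_of_collinear hγ₂
  have h3 := cross_eq_of_collinear hχ
  obtain ⟨p, q⟩ := γ
  obtain ⟨c, d⟩ := χ
  obtain ⟨hx1, hx2⟩ := hx
  obtain ⟨hy1, hy2⟩ := hy
  simp only at *
  subst hχy
  have hne : h - q ≠ 0 := by
    intro h0
    have hq : q = h := by linarith
    subst hq
    have : v * q = 0 := by linarith
    have := mul_pos hv hh
    linarith
  apply mul_right_cancel₀ hne
  linarith
end

section
/- Let v, h, w be real numbers with v > 0, h > 0 and w > v + 3/2, and let x, y ∈ [1/2, 2]. Put g₁ := (−w − 1/2 + x, 0), g₂ := (w − 2 + y, 0), e₁ := (−v, h), e₂ := (v, h), e₃ := (0, h). Suppose γ ∈ ℝ² is collinear with g₁ and e₁ and also collinear with g₂ and e₂, and suppose χ ∈ ℝ² has y-coordinate −h and is collinear with γ and e₃. Then the x-coordinate of χ equals x + y − 5/2. (This is the coordinate computation underlying the ≤-addition gadget, the mirror image of the ≥-addition gadget.) -/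
theorem collinear_cross (p q r : ℝ × ℝ) (hc : Collinear ℝ ({p, q, r} : Set (ℝ × ℝ))) :
    (q.1 - p.1) * (r.2 - p.2) = (r.1 - p.1) * (q.2 - p.2) := by
  rw [collinear_iff_of_mem (p₀ := p) (by simp)] at hc
  obtain ⟨u, hu⟩ := hc
  obtain ⟨s, hs⟩ := hu q (by simp)
  obtain ⟨t, ht⟩ := hu r (by simp)
  subst hs ht
  simp
  ring

/-- Coordinate computation underlying the `≤`-addition gadget
(the mirror image of the `≥`-addition gadget). -/
theorem leq_addition_gadget
    (v h w x y : ℝ) (hv : 0 < v) (hh : 0 < h) (hw : v + 3/2 < w)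
    (hx : x ∈ Set.Icc (1/2 : ℝ) 2) (hy : y ∈ Set.Icc (1/2 : ℝ) 2)
    (γ χ : ℝ × ℝ)
    (hγ₁ : Collinear ℝ ({γ, (-w - 1/2 + x, 0), (-v, h)} : Set (ℝ × ℝ)))
    (hγ₂ : Collinear ℝ ({γ, (w - 2 + y, 0), (v, h)} : Set (ℝ × ℝ)))
    (hχy : χ.2 = -h)
    (hχ : Collinear ℝ ({γ, (0, h), χ} : Set (ℝ × ℝ))) :
    χ.1 = x + y - 5/2 := by
  have e1 := collinear_cross _ _ _ hγ₁
  have e2 := collinear_cross _ _ _ hγ₂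
  have e3 := collinear_cross _ _ _ hχ
  obtain ⟨c, d⟩ := γ
  obtain ⟨X, Y⟩ := χ
  simp only at e1 e2 e3 hχy ⊢
  subst hχy
  have hd : h - d ≠ 0 := by
    intro h0
    obtain rfl : h = d := by linarith
    have h1 : h * (c + v) = 0 := by linear_combination -e1
    have h2 : h * (c - v) = 0 := by linear_combination -e2
    have h3 : h * v = 0 := by linarith
    exact (mul_pos hh hv).ne' h3
  have key : (X - (x + y - 5/2)) * (h - d) = 0 := by
    linear_combination -e1 - e2 - e3
  rcases mul_eq_zero.mp key with h1 | h1
  · linarith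
  · exact absurd h1 hd
end

section
/- For every real x with 1/2 ≤ x ≤ 2 there exists a point e ∈ ℝ² such that: e is collinear with (x, 0) and (7, 541/184); e is collinear with (159/10 − 1/x, 1/10) and (9, 259139/112792); and e is collinear with (499811/70923, 38731813/13049832) and (112379/15432, 4355591/1419744). (That is, the line through the point representing value x on the lower guard segment and the left shadow corner of the umbra of the inversion gadget, and the line through the point representing value 1/x on the upper guard segment and the right shadow corner, meet on the line through the endpoints f₀, f₁ of the critical segment of the umbra.) -/
/-- A point of the form `p + t (q - p)` is collinear with `p` and `q`. -/
theorem collinear_of_param (p q e : ℝ × ℝ) (t : ℝ)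
    (h1 : e.1 = p.1 + t * (q.1 - p.1)) (h2 : e.2 = p.2 + t * (q.2 - p.2)) :
    Collinear ℝ ({p, q, e} : Set (ℝ × ℝ)) := by
  rw [collinear_iff_of_mem (p₀ := p) (by simp)]
  refine ⟨q - p, ?_⟩
  intro z hz
  simp only [Set.mem_insert_iff, Set.mem_singleton_iff] at hz
  rcases hz with rfl | rfl | rfl
  · exact ⟨0, by simp⟩
  · exact ⟨1, by simp⟩
  · refine ⟨t, Prod.ext ?_ ?_⟩
    · simp [h1]; ring
    · simp [h2]; ring

/-- In the inversion gadget, the line through the point representing value `x` on the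
lower guard segment and the left shadow corner of the umbra, and the line through the
point representing value `1/x` on the upper guard segment and the right shadow corner,
meet on the line through the endpoints `f₀, f₁` of the critical segment of the umbra. -/
theorem inversion_umbra
    (x : ℝ) (hx₁ : 1/2 ≤ x) (hx₂ : x ≤ 2) :
    ∃ e : ℝ × ℝ,
      Collinear ℝ ({(x, 0), (7, 541/184), e} : Set (ℝ × ℝ)) ∧
      Collinear ℝ ({(159/10 - 1/x, 1/10), (9, 259139/112792), e} : Set (ℝ × ℝ)) ∧
      Collinear ℝ
        ({(499811/70923, 38731813/13049832), (112379/15432, 4355591/1419744), e} :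
          Set (ℝ × ℝ)) := by
  have hx0 : x ≠ 0 := by
    apply ne_of_gt; linarith
  have hD : 36994 * x - 3065 ≠ 0 := by
    apply ne_of_gt; linarith
  refine ⟨(7 + 670 / (36994 * x - 3065) * (7 - x),
    541/184 + 670 / (36994 * x - 3065) * (541/184)), ?_, ?_, ?_⟩
  · apply collinear_of_param _ _ _ (1 + 670 / (36994 * x - 3065)) <;> dsimp only <;> ring
  · apply collinear_of_param _ _ _ (1 + 10820 * x / (36994 * x - 3065)) <;> dsimp only <;>
      field_simp <;> ring
  · apply collinear_of_param _ _ _ (10288 * (2 - x) / (36994 * x - 3065)) <;> dsimp only <;>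
      field_simp <;> ring
end

section
/- For every real x with 1/2 ≤ x ≤ 2 there exists a point e ∈ ℝ² such that: e is collinear with (x, 0) and (7, 8865/752); e is collinear with (159/10 − 1/x, 1/10) and (9, 4214815/460976); and e is collinear with (182083/25835, 231222249/19427920) and (205139/28156, 130288905/10586656). (That is, the line through the point representing value x on the lower guard segment and the left shadow corner of the nook of the inversion gadget, and the line through the point representing value 1/x on the upper guard segment and the right shadow corner, meet on the line through the endpoints f₂, f₃ of the critical segment of the nook.) -/
lemma collinear_of_cross (a b c d u v : ℝ) (h : c - a ≠ 0)
    (hc : (c - a) * (v - b) = (d - b) * (u - a)) :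
    Collinear ℝ ({(a, b), (c, d), (u, v)} : Set (ℝ × ℝ)) := by
  rw [collinear_iff_of_mem (p₀ := (a, b)) (by simp)]
  refine ⟨(c - a, d - b), ?_⟩
  intro p hp
  simp only [Set.mem_insert_iff, Set.mem_singleton_iff] at hp
  rcases hp with rfl | rfl | rfl
  · exact ⟨0, by simp⟩
  · exact ⟨1, by simp⟩
  · refine ⟨(u - a) / (c - a), ?_⟩
    ext
    · simp
      field_simp
      ring
    · simp
      field_simp
      linarith



/-- In the inversion gadget, the line through the point representing value `x` on the
lower guard segment and the left shadow corner of the nook, and the line through the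
point representing value `1/x` on the upper guard segment and the right shadow corner,
meet on the line through the endpoints `f₂, f₃` of the critical segment of the nook. -/
theorem inversion_nook
    (x : ℝ) (hx₁ : 1/2 ≤ x) (hx₂ : x ≤ 2) :
    ∃ e : ℝ × ℝ,
      Collinear ℝ ({(x, 0), (7, 8865/752), e} : Set (ℝ × ℝ)) ∧
      Collinear ℝ ({(159/10 - 1/x, 1/10), (9, 4214815/460976), e} : Set (ℝ × ℝ)) ∧
      Collinear ℝ
        ({(182083/25835, 231222249/19427920), (205139/28156, 130288905/10586656), e} :
          Set (ℝ × ℝ)) := by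
  have hx : x ≠ 0 := by linarith
  have hD : (16551 : ℝ) + (-202038) * x ≠ 0 := by
    apply ne_of_lt
    linarith
  obtain ⟨t, ht⟩ : ∃ t : ℝ, t * ((16551 : ℝ) + (-202038) * x) = (-112624) + (56312) * x :=
    ⟨_, div_mul_cancel₀ _ hD⟩
  refine ⟨(182083/25835 + t * (205139/28156 - 182083/25835),
    231222249/19427920 + t * (130288905/10586656 - 231222249/19427920)), ?_, ?_, ?_⟩
  · apply collinear_of_cross
    · intro h
      linarith
    · linear_combination (1097487/547012515520 : ℝ) * ht
  · apply collinear_of_cross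
    · intro h
      have h2 : 1 / x ≤ 2 := by
        rw [div_le_iff₀ (by linarith)]
        linarith
      linarith
    · have hy : x * (1 / x) = 1 := mul_one_div_cancel hx
      generalize 1 / x = y at hy ⊢
      linear_combination (4106186639/167659336006880 : ℝ) * y * ht + (4106186639/167659336006880 : ℝ) * (56312 - (-202038) * t) * hy
  · apply collinear_of_cross
    · norm_num
    · ring
end

section
/- For all real numbers x, v₁, v₂, v₃, v₄, v₅, v₆, v₇, v₈, v₉, v₁₀, v₁₁, v₁₂ satisfying the equations v₁ = x + 3/4, v₂·v₁ = 1, v₃ + 1 = v₁, v₄·v₃ = 1, v₅ + v₂ = v₄, v₅·v₆ = 1, v₇ = x + 7/8, v₈ + 3/4 = v₇, v₉ + v₉ = v₈, v₁₀ + v₉ = v₆, v₁₁ = v₁₀ + 3/4, and v₁₂ + 1/2 = v₁₁, it holds that v₁₂ = x². Moreover, for every x with 7/8 ≤ x ≤ 9/8 there exist real numbers v₁, …, v₁₂, all lying in the interval [1/2, 2], satisfying these equations. -/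
/-- The squaring construction of the reduction to ETR-INV: the listed equations,
using only addition, inversion and rational constants, force `v₁₂ = x²`; moreover,
for `x ∈ [7/8, 9/8]` they can be satisfied with all auxiliary values in `[1/2, 2]`. -/
theorem etrinv_squaring :
    (∀ x v₁ v₂ v₃ v₄ v₅ v₆ v₇ v₈ v₉ v₁₀ v₁₁ v₁₂ : ℝ,
      v₁ = x + 3/4 → v₂ * v₁ = 1 → v₃ + 1 = v₁ → v₄ * v₃ = 1 → v₅ + v₂ = v₄ →
      v₅ * v₆ = 1 → v₇ = x + 7/8 → v₈ + 3/4 = v₇ → v₉ + v₉ = v₈ → v₁₀ + v₉ = v₆ →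
      v₁₁ = v₁₀ + 3/4 → v₁₂ + 1/2 = v₁₁ → v₁₂ = x ^ 2) ∧
    (∀ x : ℝ, 7/8 ≤ x → x ≤ 9/8 →
      ∃ v₁ v₂ v₃ v₄ v₅ v₆ v₇ v₈ v₉ v₁₀ v₁₁ v₁₂ : ℝ,
        v₁ ∈ Set.Icc (1/2 : ℝ) 2 ∧ v₂ ∈ Set.Icc (1/2 : ℝ) 2 ∧
        v₃ ∈ Set.Icc (1/2 : ℝ) 2 ∧ v₄ ∈ Set.Icc (1/2 : ℝ) 2 ∧
        v₅ ∈ Set.Icc (1/2 : ℝ) 2 ∧ v₆ ∈ Set.Icc (1/2 : ℝ) 2 ∧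
        v₇ ∈ Set.Icc (1/2 : ℝ) 2 ∧ v₈ ∈ Set.Icc (1/2 : ℝ) 2 ∧
        v₉ ∈ Set.Icc (1/2 : ℝ) 2 ∧ v₁₀ ∈ Set.Icc (1/2 : ℝ) 2 ∧
        v₁₁ ∈ Set.Icc (1/2 : ℝ) 2 ∧ v₁₂ ∈ Set.Icc (1/2 : ℝ) 2 ∧
        v₁ = x + 3/4 ∧ v₂ * v₁ = 1 ∧ v₃ + 1 = v₁ ∧ v₄ * v₃ = 1 ∧ v₅ + v₂ = v₄ ∧
        v₅ * v₆ = 1 ∧ v₇ = x + 7/8 ∧ v₈ + 3/4 = v₇ ∧ v₉ + v₉ = v₈ ∧ v₁₀ + v₉ = v₆ ∧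
        v₁₁ = v₁₀ + 3/4 ∧ v₁₂ + 1/2 = v₁₁) := by
  constructor
  · intro x v₁ v₂ v₃ v₄ v₅ v₆ v₇ v₈ v₉ v₁₀ v₁₁ v₁₂ h1 h2 h3 h4 h5 h6 h7 h8 h9 h10 h11 h12
    have a : v₅ * (v₁ * v₃) = 1 := by
      have e : v₅ = v₄ - v₂ := by linarith
      rw [e]
      linear_combination v₁ * h4 - v₃ * h2 - h3
    have b : v₆ = v₁ * v₃ := by
      linear_combination (-v₆) * a + v₁ * v₃ * h6
    have c : v₃ = x - 1/4 := by linarith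
    rw [h1, c] at b
    linear_combination b + h12 + h11 + h10 - h9 / 2 - h8 / 2 - h7 / 2
  · intro x hl hu
    have p1 : 0 < x + 3/4 := by linarith
    have p3 : 0 < x - 1/4 := by linarith
    have p6 : 0 < (x + 3/4) * (x - 1/4) := mul_pos p1 p3
    have q3 : x * 4 - 1 ≠ 0 := by intro h; linarith
    have q4 : 4 * x - 1 ≠ 0 := by intro h; linarith
    refine ⟨x + 3/4, 1 / (x + 3/4), x - 1/4, 1 / (x - 1/4), 1 / ((x + 3/4) * (x - 1/4)),
      (x + 3/4) * (x - 1/4), x + 7/8, x + 1/8, x / 2 + 1/16, x ^ 2 - 1/4, x ^ 2 + 1/2, x ^ 2,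
      ⟨?_, ?_⟩, ⟨?_, ?_⟩, ⟨?_, ?_⟩, ⟨?_, ?_⟩, ⟨?_, ?_⟩, ⟨?_, ?_⟩, ⟨?_, ?_⟩, ⟨?_, ?_⟩,
      ⟨?_, ?_⟩, ⟨?_, ?_⟩, ⟨?_, ?_⟩, ⟨?_, ?_⟩, ?_, ?_, ?_, ?_, ?_, ?_, ?_, ?_, ?_, ?_, ?_, ?_⟩
    all_goals first
      | linarith
      | nlinarith
      | (rw [div_le_div_iff₀ (by norm_num) (by assumption)]; nlinarith)
      | (rw [div_le_iff₀ (by assumption)]; nlinarith)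
      | exact one_div_mul_cancel (ne_of_gt (by assumption))
      | (field_simp; done)
      | (field_simp; ring)
end

section
/- For all real numbers x, y, z, p, q, r, s, t, u, w, w', a, a', a_h, b, b', b_h, m, m_s, m_q, c, c' satisfying the equations p = x + 7/8, q + q = p, r = y + 7/8, s + s = r, q + s = t, u + 7/8 = t, w = u·u, w' = w + 1/2, a = x·x, a' = a + 1/2, a_h + a_h = a', b = y·y, b' = b + 1/2, b_h + b_h = b', m = a_h + b_h, m_s + 1/2 = m, m_q + m_q = m, m_q + c = w', c' = c + c, and z + 1/2 = c', it holds that z = x·y. Moreover, for all x, y with 7/8 ≤ x, y ≤ 9/8, setting z = x·y there exist real numbers p, q, r, s, t, u, w, w', a, a', a_h, b, b', b_h, m, m_s, m_q, c, c', all lying in the interval [1/2, 2], satisfying these equations. -/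
/-- The multiplication construction of the reduction to ETR-INV: using the identity
`(x+y)² − x² − y² = 2xy`, the listed equations force `z = x·y`; moreover, for
`x, y ∈ [7/8, 9/8]` and `z = x·y` they can be satisfied with all auxiliary values
in `[1/2, 2]`. -/
theorem etrinv_multiplication :
    (∀ x y z p q r s t u w w' a a' ah b b' bh m ms mq c c' : ℝ,
      p = x + 7/8 → q + q = p → r = y + 7/8 → s + s = r → q + s = t →
      u + 7/8 = t → w = u * u → w' = w + 1/2 → a = x * x → a' = a + 1/2 →
      ah + ah = a' → b = y * y → b' = b + 1/2 → bh + bh = b' → m = ah + bh →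
      ms + 1/2 = m → mq + mq = m → mq + c = w' → c' = c + c → z + 1/2 = c' →
      z = x * y) ∧
    (∀ x y : ℝ, 7/8 ≤ x → x ≤ 9/8 → 7/8 ≤ y → y ≤ 9/8 →
      ∃ p q r s t u w w' a a' ah b b' bh m ms mq c c' : ℝ,
        p ∈ Set.Icc (1/2 : ℝ) 2 ∧ q ∈ Set.Icc (1/2 : ℝ) 2 ∧
        r ∈ Set.Icc (1/2 : ℝ) 2 ∧ s ∈ Set.Icc (1/2 : ℝ) 2 ∧
        t ∈ Set.Icc (1/2 : ℝ) 2 ∧ u ∈ Set.Icc (1/2 : ℝ) 2 ∧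
        w ∈ Set.Icc (1/2 : ℝ) 2 ∧ w' ∈ Set.Icc (1/2 : ℝ) 2 ∧
        a ∈ Set.Icc (1/2 : ℝ) 2 ∧ a' ∈ Set.Icc (1/2 : ℝ) 2 ∧
        ah ∈ Set.Icc (1/2 : ℝ) 2 ∧ b ∈ Set.Icc (1/2 : ℝ) 2 ∧
        b' ∈ Set.Icc (1/2 : ℝ) 2 ∧ bh ∈ Set.Icc (1/2 : ℝ) 2 ∧
        m ∈ Set.Icc (1/2 : ℝ) 2 ∧ ms ∈ Set.Icc (1/2 : ℝ) 2 ∧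
        mq ∈ Set.Icc (1/2 : ℝ) 2 ∧ c ∈ Set.Icc (1/2 : ℝ) 2 ∧
        c' ∈ Set.Icc (1/2 : ℝ) 2 ∧
        p = x + 7/8 ∧ q + q = p ∧ r = y + 7/8 ∧ s + s = r ∧ q + s = t ∧
        u + 7/8 = t ∧ w = u * u ∧ w' = w + 1/2 ∧ a = x * x ∧ a' = a + 1/2 ∧
        ah + ah = a' ∧ b = y * y ∧ b' = b + 1/2 ∧ bh + bh = b' ∧ m = ah + bh ∧
        ms + 1/2 = m ∧ mq + mq = m ∧ mq + c = w' ∧ c' = c + c ∧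
        x * y + 1/2 = c') := by
  constructor
  · intro x y z p q r s t u w w' a a' ah b b' bh m ms mq c c' h1 h2 h3 h4 h5 h6 h7 h8 h9 h10
      h11 h12 h13 h14 h15 h16 h17 h18 h19 h20
    have hu : u = (x + y) / 2 := by linarith
    subst hu
    nlinarith
  · intro x y hx1 hx2 hy1 hy2
    have key : ∀ v v' : ℝ, 7/8 ≤ v → v ≤ 9/8 → 7/8 ≤ v' → v' ≤ 9/8 →
        49/64 ≤ v * v' ∧ v * v' ≤ 81/64 := by
      intro v v' h1 h2 h3 h4
      constructor <;> nlinarith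
    obtain ⟨ha1, ha2⟩ := key x x hx1 hx2 hx1 hx2
    obtain ⟨hb1, hb2⟩ := key y y hy1 hy2 hy1 hy2
    obtain ⟨hc1, hc2⟩ := key x y hx1 hx2 hy1 hy2
    obtain ⟨hw1, hw2⟩ := key ((x + y) / 2) ((x + y) / 2) (by linarith) (by linarith)
      (by linarith) (by linarith)
    refine ⟨x + 7/8, (x + 7/8) / 2, y + 7/8, (y + 7/8) / 2, (x + y) / 2 + 7/8, (x + y) / 2,
      (x + y) / 2 * ((x + y) / 2), (x + y) / 2 * ((x + y) / 2) + 1/2, x * x, x * x + 1/2,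
      (x * x + 1/2) / 2, y * y, y * y + 1/2, (y * y + 1/2) / 2,
      (x * x + 1/2) / 2 + (y * y + 1/2) / 2, (x * x + 1/2) / 2 + (y * y + 1/2) / 2 - 1/2,
      ((x * x + 1/2) / 2 + (y * y + 1/2) / 2) / 2, (x * y + 1/2) / 2, x * y + 1/2,
      ?_, ?_, ?_, ?_, ?_, ?_, ?_, ?_, ?_, ?_, ?_, ?_, ?_, ?_, ?_, ?_, ?_, ?_, ?_,
      ?_, ?_, ?_, ?_, ?_, ?_, ?_, ?_, ?_, ?_, ?_, ?_, ?_, ?_, ?_, ?_, ?_, ?_, ?_, ?_⟩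
    all_goals first
      | exact ⟨by linarith, by linarith⟩
      | ring
end

section
/- For all real numbers a, b, c, d, e, f, g, h, m, m', p, q, r satisfying the equations a + b = c, d + 7/8 = c, a + 1 = e, f + 7/8 = e, b + 1 = g, h + 7/8 = g, f·h = m, m + 1/2 = m', p + d = m', p + 1 = q, and r + 3/4 = q, it holds that r − 7/8 = (a − 7/8)·(b − 7/8). Moreover, for all x, y with −1/8 ≤ x, y ≤ 1/8, there exist real numbers a, b, c, d, e, f, g, h, m, m', p, q, r, all lying in the interval [1/2, 2], satisfying these equations with a = x + 7/8, b = y + 7/8 and r = x·y + 7/8. -/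
/-- The shifting construction of the reduction from ETR[1/8] (variables in
[−1/8, 1/8]) to ETR[1] (variables in [1/2, 2]): the listed equations encode the
multiplication constraint after shifting each variable by 7/8. -/
theorem etrinv_shifting :
    (∀ a b c d e f g h m m' p q r : ℝ,
      a + b = c → d + 7/8 = c → a + 1 = e → f + 7/8 = e → b + 1 = g →
      h + 7/8 = g → f * h = m → m + 1/2 = m' → p + d = m' → p + 1 = q →
      r + 3/4 = q → r - 7/8 = (a - 7/8) * (b - 7/8)) ∧
    (∀ x y : ℝ, -1/8 ≤ x → x ≤ 1/8 → -1/8 ≤ y → y ≤ 1/8 →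
      ∃ a b c d e f g h m m' p q r : ℝ,
        a ∈ Set.Icc (1/2 : ℝ) 2 ∧ b ∈ Set.Icc (1/2 : ℝ) 2 ∧
        c ∈ Set.Icc (1/2 : ℝ) 2 ∧ d ∈ Set.Icc (1/2 : ℝ) 2 ∧
        e ∈ Set.Icc (1/2 : ℝ) 2 ∧ f ∈ Set.Icc (1/2 : ℝ) 2 ∧
        g ∈ Set.Icc (1/2 : ℝ) 2 ∧ h ∈ Set.Icc (1/2 : ℝ) 2 ∧
        m ∈ Set.Icc (1/2 : ℝ) 2 ∧ m' ∈ Set.Icc (1/2 : ℝ) 2 ∧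
        p ∈ Set.Icc (1/2 : ℝ) 2 ∧ q ∈ Set.Icc (1/2 : ℝ) 2 ∧
        r ∈ Set.Icc (1/2 : ℝ) 2 ∧
        a + b = c ∧ d + 7/8 = c ∧ a + 1 = e ∧ f + 7/8 = e ∧ b + 1 = g ∧
        h + 7/8 = g ∧ f * h = m ∧ m + 1/2 = m' ∧ p + d = m' ∧ p + 1 = q ∧
        r + 3/4 = q ∧ a = x + 7/8 ∧ b = y + 7/8 ∧ r = x * y + 7/8) := by
  constructor
  · intro a b c d e f g h m m' p q r h1 h2 h3 h4 h5 h6 h7 h8 h9 h10 h11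
    have hf : f = a + 1/8 := by linarith
    have hh : h = b + 1/8 := by linarith
    subst hf hh
    linarith
  · intro x y hx1 hx2 hy1 hy2
    have hl : -1/64 ≤ x * y := by
      nlinarith [mul_nonneg (sub_nonneg.2 hx1) (sub_nonneg.2 hy2),
        mul_nonneg (sub_nonneg.2 hx2) (sub_nonneg.2 hy1)]
    have hu : x * y ≤ 1/64 := by
      nlinarith [mul_nonneg (sub_nonneg.2 hx1) (sub_nonneg.2 hy1),
        mul_nonneg (sub_nonneg.2 hx2) (sub_nonneg.2 hy2),
        sq_nonneg (x - y), sq_nonneg (x + y)]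
    refine ⟨x + 7/8, y + 7/8, x + y + 7/4, x + y + 7/8, x + 15/8, x + 1, y + 15/8, y + 1,
      x * y + x + y + 1, x * y + x + y + 3/2, x * y + 5/8, x * y + 13/8, x * y + 7/8,
      ?_, ?_, ?_, ?_, ?_, ?_, ?_, ?_, ?_, ?_, ?_, ?_, ?_,
      ?_, ?_, ?_, ?_, ?_, ?_, ?_, ?_, ?_, ?_, ?_, rfl, rfl, rfl⟩
    all_goals first
      | ring1
      | (constructor <;> linarith)
end

section
/- Let S ⊆ ℝ² be a nonempty open convex set, and let a, b, c be three pairwise distinct extreme points of the closure of S. Then the centroid (a + b + c)/3 belongs to S. -/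
/-- The centroid of three pairwise distinct extreme points of the closure of a
nonempty open convex planar set belongs to the set. -/
theorem centroid_of_extreme_points_mem
    (S : Set (ℝ × ℝ)) (hne : S.Nonempty) (hopen : IsOpen S) (hconv : Convex ℝ S)
    (a b c : ℝ × ℝ)
    (ha : a ∈ (closure S).extremePoints ℝ)
    (hb : b ∈ (closure S).extremePoints ℝ)
    (hc : c ∈ (closure S).extremePoints ℝ)
    (hab : a ≠ b) (hac : a ≠ c) (hbc : b ≠ c) :
    (3 : ℝ)⁻¹ • (a + b + c) ∈ S := by
  by_contra hg
  obtain ⟨f, hf⟩ := geometric_hahn_banach_open_point hconv hopen hg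
  rw [mem_extremePoints_iff_forall_segment] at ha hb hc
  have hcl : ∀ x ∈ closure S, f x ≤ f ((3 : ℝ)⁻¹ • (a + b + c)) := by
    intro x hx
    exact closure_minimal (fun y hy => (hf y hy).le)
      (isClosed_le f.continuous continuous_const) hx
  have h1 := hcl a ha.1
  have h2 := hcl b hb.1
  have h3 := hcl c hc.1
  obtain ⟨s, hs⟩ := hne
  have h4 := hf s hs
  simp only [map_smul, map_add, smul_eq_mul] at h1 h2 h3 h4
  have eb : f b = f a := by linarith
  have ec : f c = f a := by linarith
  have es : f s < f a := by linarith
  have hrep : ∀ x : ℝ × ℝ, f x = x.1 * f (1, 0) + x.2 * f (0, 1) := by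
    intro x
    have : x = x.1 • ((1, 0) : ℝ × ℝ) + x.2 • ((0, 1) : ℝ × ℝ) := by ext <;> simp
    conv_lhs => rw [this]
    simp only [map_add, map_smul, smul_eq_mul]
  rw [hrep s, hrep a] at es
  rw [hrep b, hrep a] at eb
  rw [hrep c, hrep a] at ec
  generalize f (1, 0) = p at *
  generalize f (0, 1) = q at *
  have hpq : p ^ 2 + q ^ 2 ≠ 0 := by
    intro h
    have hp : p = 0 := by nlinarith [sq_nonneg p, sq_nonneg q]
    have hq : q = 0 := by nlinarith [sq_nonneg p, sq_nonneg q]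
    simp [hp, hq] at es
  have key : ∀ x : ℝ × ℝ, x.1 * p + x.2 * q = a.1 * p + a.2 * q →
      ∃ r : ℝ, x = r • ((-q, p) : ℝ × ℝ) +ᵥ a := by
    intro x hx
    refine ⟨(p * (x.2 - a.2) - q * (x.1 - a.1)) / (p ^ 2 + q ^ 2), ?_⟩
    ext
    · simp
      field_simp
      linear_combination p * hx
    · simp
      field_simp
      linear_combination q * hx
  have hcol : Collinear ℝ ({a, b, c} : Set (ℝ × ℝ)) := by
    rw [collinear_iff_of_mem (p₀ := a) (by simp)]
    refine ⟨(-q, p), ?_⟩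
    intro x hx
    simp only [Set.mem_insert_iff, Set.mem_singleton_iff] at hx
    rcases hx with rfl | rfl | rfl
    · exact key _ rfl
    · exact key _ eb
    · exact key _ ec
  rcases hcol.wbtw_or_wbtw_or_wbtw with h | h | h
  · rcases hb.2 a ha.1 c hc.1 (mem_segment_iff_wbtw.2 h) with h | h
    · exact hab h
    · exact hbc h.symm
  · rcases hc.2 b hb.1 a ha.1 (mem_segment_iff_wbtw.2 h) with h | h
    · exact hbc h
    · exact hac h
  · rcases ha.2 c hc.1 b hb.1 (mem_segment_iff_wbtw.2 h) with h | h
    · exact hac h.symm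
    · exact hab h.symm
end

section
/- Let P ⊆ ℝ² be a closed set and g a natural number. For each n ∈ ℕ let Gⁿ : Fin g → ℝ² be a g-tuple of points such that Gⁿ(j) ∈ P for every j and every point of P is seen by Gⁿ(j) for some j. Suppose that for every j the sequence (Gⁿ(j))ₙ converges to a point G*(j) as n → ∞. Then G*(j) ∈ P for every j, and every point of P is seen by G*(j) for some j; that is, the limit tuple G* is again a guard set of P of size g. -/
/-- The space of guard sets of size `g` of a closed set `P`, viewed as tuples,
is closed: the pointwise limit of a sequence of guard tuples is a guard tuple. -/
theorem guard_sets_closed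
    (P : Set (ℝ × ℝ)) (hP : IsClosed P) (g : ℕ)
    (G : ℕ → Fin g → ℝ × ℝ) (Gstar : Fin g → ℝ × ℝ)
    (hmem : ∀ n j, G n j ∈ P)
    (hguard : ∀ n, ∀ q ∈ P, ∃ j, Sees P (G n j) q)
    (hlim : ∀ j, Filter.Tendsto (fun n => G n j) Filter.atTop (nhds (Gstar j))) :
    (∀ j, Gstar j ∈ P) ∧ ∀ q ∈ P, ∃ j, Sees P (Gstar j) q := by
  refine ⟨fun j => hP.mem_of_tendsto (hlim j) (Filter.Eventually.of_forall fun n => hmem n j), ?_⟩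
  intro q hq
  have hfreq : ∃ j, ∃ᶠ n in Filter.atTop, Sees P (G n j) q := by
    by_contra hcon
    push Not at hcon
    have hall : ∀ᶠ n in Filter.atTop, ∀ j, ¬ Sees P (G n j) q :=
      Filter.eventually_all.2 hcon
    obtain ⟨n, hn⟩ := hall.exists
    obtain ⟨j, hj⟩ := hguard n q hq
    exact hn j hj
  obtain ⟨j, hj⟩ := hfreq
  refine ⟨j, ?_⟩
  rintro x ⟨a, b, ha, hb, hab, rfl⟩
  have ht : Filter.Tendsto (fun n => a • G n j + b • q) Filter.atTop
      (nhds (a • Gstar j + b • q)) := ((hlim j).const_smul a).add_const _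
  exact hP.mem_of_frequently_of_tendsto
    (hj.mono fun n hn => hn ⟨a, b, ha, hb, hab, rfl⟩) ht
end
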